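/- Suppose k = n−3 (so n ≥ 5 and gcd(n, 6) = 1). Then Δ_{n,n−3} = Σ_{r=2}^{(n−1)/2} (−1)^{r−1} T_r in ⋀² M. -/

import Mathlib

open scoped Classical

noncomputable section

namespace Stmt

open ExteriorAlgebra

/-- `T n e r = Σ_{i=0}^{n-1} e_i ∧ e_{i+r}` in the exterior algebra of `M`. -/
def T (n : ℕ) {M : Type*} [AddCommGroup M] [Module ℤ M] (e : ZMod n → M)
    (r : ZMod n) : ExteriorAlgebra ℤ M :=
  ∑ i ∈ Finset.range n, ι ℤ (e i) * ι ℤ (e ((i : ZMod n) + r))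

/-- The coefficient `c_{I,J} = a⁺_{I,J} − a⁻_{I,J}`. -/
def cIJ (n k c : ℕ) (I J : ℕ) : ℤ :=
  (if ∃ j ∈ Finset.Icc 1 (c - 1),
      ((J : ZMod n) - (I : ZMod n)) = (j : ZMod n) * ((k : ZMod n) + 1) then 1 else 0)
  - (if ∃ j ∈ Finset.Icc 1 (c - 1),
      ((J : ZMod n) - (I : ZMod n)) = (j : ZMod n) * ((k : ZMod n) + 1) - 1 then 1 else 0)

/-- The classifying element `Δ_{n,k} = Σ_{1 ≤ I < J ≤ n−1} c_{I,J} · e_I ∧ e_J`. -/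
def Δ (n k c : ℕ) {M : Type*} [AddCommGroup M] [Module ℤ M] (e : ZMod n → M) :
    ExteriorAlgebra ℤ M :=
  ∑ I ∈ Finset.Icc 1 (n - 1), ∑ J ∈ Finset.Ioc I (n - 1),
    cIJ n k c I J • (ι ℤ (e (I : ZMod n)) * ι ℤ (e (J : ZMod n)))

lemma zdvd (m a : ℕ) (h1 : 0 < a) (h2 : a < 2 * (2 * m + 1)) :
    ((a : ℕ) : ZMod (2 * m + 1)) = 0 ↔ a = 2 * m + 1 := by
  rw [ZMod.natCast_eq_zero_iff]
  constructor
  · rintro ⟨q, rfl⟩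
    have hq0 : q ≠ 0 := by rintro rfl; simp at h1
    have hq2 : q < 2 := by
      by_contra h
      push Not at h
      nlinarith
    have : q = 1 := by omega
    subst this; ring
  · rintro rfl; exact dvd_rfl

lemma cIJ_eq (m I d : ℕ) (hm : 2 ≤ m) (hd1 : 1 ≤ d) (hd2 : d ≤ 2 * m - 1) :
    cIJ (2 * m + 1) (2 * m - 2) m I (I + d) = if d = 1 then 0 else (-1) ^ (d - 1) := by
  have hk : ((2 * m - 2 : ℕ) : ZMod (2 * m + 1)) + 1 = -2 := by
    have h0 : ((2 * m + 1 : ℕ) : ZMod (2 * m + 1)) = 0 := ZMod.natCast_self _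
    have h1 : ((2 * m - 2 : ℕ) : ZMod (2 * m + 1)) + 1 + 2 = ((2 * m + 1 : ℕ) : ZMod (2 * m + 1)) := by
      have h2 : ((2 * m - 2 + 1 + 2 : ℕ) : ZMod (2 * m + 1)) = ((2 * m + 1 : ℕ) : ZMod (2 * m + 1)) := by
        congr 1; omega
      rw [← h2, Nat.cast_add, Nat.cast_add]
      norm_num
    rw [h0] at h1
    exact eq_neg_of_add_eq_zero_left h1
  have hA : (∃ j ∈ Finset.Icc 1 (m - 1), (((I + d : ℕ) : ZMod (2 * m + 1)) - (I : ZMod (2 * m + 1)))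
      = (j : ZMod (2 * m + 1)) * (-2)) ↔ (d ≠ 1 ∧ d % 2 = 1) := by
    have key : ∀ j ∈ Finset.Icc 1 (m - 1), ((((I + d : ℕ) : ZMod (2 * m + 1)) - (I : ZMod (2 * m + 1)))
      = (j : ZMod (2 * m + 1)) * (-2) ↔ d + 2 * j = 2 * m + 1) := by
      intro j hj
      rw [Finset.mem_Icc] at hj
      rw [← zdvd m (d + 2 * j) (by omega) (by omega), ← sub_eq_zero]
      push_cast
      ring_nf
    constructor
    · rintro ⟨j, hj, h⟩
      rw [key j hj] at h
      rw [Finset.mem_Icc] at hj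
      omega
    · rintro h
      have hj : (2 * m + 1 - d) / 2 ∈ Finset.Icc 1 (m - 1) := by rw [Finset.mem_Icc]; omega
      exact ⟨_, hj, (key _ hj).2 (by omega)⟩
  have hB : (∃ j ∈ Finset.Icc 1 (m - 1), (((I + d : ℕ) : ZMod (2 * m + 1)) - (I : ZMod (2 * m + 1)))
      = (j : ZMod (2 * m + 1)) * (-2) - 1) ↔ d % 2 = 0 := by
    have key : ∀ j ∈ Finset.Icc 1 (m - 1), ((((I + d : ℕ) : ZMod (2 * m + 1)) - (I : ZMod (2 * m + 1)))
      = (j : ZMod (2 * m + 1)) * (-2) - 1 ↔ d + 2 * j + 1 = 2 * m + 1) := by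
      intro j hj
      rw [Finset.mem_Icc] at hj
      rw [← zdvd m (d + 2 * j + 1) (by omega) (by omega), ← sub_eq_zero]
      push_cast
      ring_nf
    constructor
    · rintro ⟨j, hj, h⟩
      rw [key j hj] at h
      omega
    · rintro h
      have hj : (2 * m - d) / 2 ∈ Finset.Icc 1 (m - 1) := by rw [Finset.mem_Icc]; omega
      exact ⟨_, hj, (key _ hj).2 (by omega)⟩
  unfold cIJ
  rw [hk]
  simp only [hA, hB]
  rcases Nat.even_or_odd d with h | h
  · have h2 : d % 2 = 0 := Nat.even_iff.1 h
    have h3 : Odd (d - 1) := by rw [Nat.odd_iff]; omega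
    have h4 : d ≠ 1 := by omega
    simp [h2, h3.neg_one_pow, h4]
  · have h2 : d % 2 = 1 := Nat.odd_iff.1 h
    have h3 : Even (d - 1) := by rw [Nat.even_iff]; omega
    simp only [h2, h3.neg_one_pow]
    by_cases h4 : d = 1 <;> simp [h4]

/-- Non-wrapping part of `T`. -/
def S (n : ℕ) {M : Type*} [AddCommGroup M] [Module ℤ M] (e : ZMod n → M) (d : ℕ) :
    ExteriorAlgebra ℤ M :=
  ∑ i ∈ Finset.range (n - d), ι ℤ (e (i : ZMod n)) * ι ℤ (e ((i + d : ℕ) : ZMod n))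

lemma T_eq (n : ℕ) {M : Type*} [AddCommGroup M] [Module ℤ M] (e : ZMod n → M) (r : ℕ)
    (hr : r ≤ n) : T n e (r : ZMod n) = S n e r - S n e (n - r) := by
  unfold T S
  have h : n = (n - r) + r := by omega
  have h' : n - (n - r) = r := by omega
  rw [h']
  have : Finset.range n = Finset.range ((n - r) + r) := by rw [← h]
  rw [this, Finset.sum_range_add, sub_eq_add_neg, ← Finset.sum_neg_distrib]
  congr 1
  · refine Finset.sum_congr rfl fun i _ => ?_
    push_cast
    rfl
  · refine Finset.sum_congr rfl fun i _ => ?_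
    have h1 : (((n - r + i : ℕ) : ZMod n) + (r : ZMod n)) = (i : ZMod n) := by
      have : ((n - r + i + r : ℕ) : ZMod n) = ((n + i : ℕ) : ZMod n) := by
        congr 1; omega
      push_cast at this ⊢
      rw [this]; simp
    rw [h1, add_comm i]
    exact eq_neg_of_add_eq_zero_left (ι_add_mul_swap _ _)

lemma S_eq (n : ℕ) {M : Type*} [AddCommGroup M] [Module ℤ M] (e : ZMod n → M) (he0 : e 0 = 0)
    (d : ℕ) : S n e d =
      ∑ i ∈ Finset.Icc 1 (n - 1 - d), ι ℤ (e (i : ZMod n)) * ι ℤ (e ((i + d : ℕ) : ZMod n)) := by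
  unfold S
  symm
  apply Finset.sum_subset_zero_on_sdiff
  · intro i hi
    rw [Finset.mem_Icc] at hi
    rw [Finset.mem_range]; omega
  · intro i hi
    rw [Finset.mem_sdiff, Finset.mem_Icc, Finset.mem_range] at hi
    have : i = 0 := by omega
    subst this
    simp [he0]
  · intros; rfl

lemma Delta_eq (m : ℕ) (hm : 2 ≤ m) {M : Type*} [AddCommGroup M] [Module ℤ M]
    (e : ZMod (2 * m + 1) → M) (he0 : e 0 = 0) :
    Δ (2 * m + 1) (2 * m - 2) m e =
      ∑ d ∈ Finset.Icc 2 (2 * m - 1), ((-1 : ℤ) ^ (d - 1)) • S (2 * m + 1) e d := by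
  unfold Δ
  have h1 : ∀ I ∈ Finset.Icc 1 (2 * m + 1 - 1),
      (∑ J ∈ Finset.Ioc I (2 * m + 1 - 1), cIJ (2 * m + 1) (2 * m - 2) m I J •
        (ι ℤ (e (I : ZMod (2 * m + 1))) * ι ℤ (e (J : ZMod (2 * m + 1))))) =
      ∑ d ∈ Finset.Icc 1 (2 * m - I), (if d = 1 then (0 : ℤ) else (-1) ^ (d - 1)) •
        (ι ℤ (e (I : ZMod (2 * m + 1))) * ι ℤ (e ((I + d : ℕ) : ZMod (2 * m + 1)))) := by
    intro I hI
    rw [Finset.mem_Icc] at hI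
    symm
    refine Finset.sum_bij (fun d _ => I + d) ?_ ?_ ?_ ?_
    · intro d hd
      rw [Finset.mem_Icc] at hd
      rw [Finset.mem_Ioc]; omega
    · intro a _ b _ h
      simpa using h
    · intro J hJ
      rw [Finset.mem_Ioc] at hJ
      exact ⟨J - I, by rw [Finset.mem_Icc]; omega, by omega⟩
    · intro d hd
      rw [Finset.mem_Icc] at hd
      rw [cIJ_eq m I d hm (by omega) (by omega)]
  rw [Finset.sum_congr rfl h1]
  rw [Finset.sum_comm' (t' := Finset.Icc 1 (2 * m - 1))
    (s' := fun d => Finset.Icc 1 (2 * m + 1 - 1 - d))]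
  · symm
    apply Finset.sum_subset_zero_on_sdiff
    · intro d hd
      rw [Finset.mem_Icc] at *; omega
    · intro d hd
      rw [Finset.mem_sdiff, Finset.mem_Icc, Finset.mem_Icc] at hd
      have : d = 1 := by omega
      simp [this]
    · intro d hd
      rw [Finset.mem_Icc] at hd
      have : d ≠ 1 := by omega
      simp only [this, if_false]
      rw [← Finset.smul_sum, S_eq _ _ he0]
  · intro x y
    simp only [Finset.mem_Icc]
    omega

lemma fold_sum (m : ℕ) (hm : 2 ≤ m) {A : Type*} [AddCommGroup A] (S : ℕ → A) :
    ∑ d ∈ Finset.Icc 2 (2 * m - 1), ((-1 : ℤ) ^ (d - 1)) • S d =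
      ∑ r ∈ Finset.Icc 2 m, ((-1 : ℤ) ^ (r - 1)) • (S r - S (2 * m + 1 - r)) := by
  simp only [smul_sub]
  rw [Finset.sum_sub_distrib, sub_eq_add_neg, ← Finset.sum_neg_distrib]
  have h : ∑ r ∈ Finset.Icc 2 m, -(((-1 : ℤ) ^ (r - 1)) • S (2 * m + 1 - r)) =
      ∑ d ∈ Finset.Icc (m + 1) (2 * m - 1), ((-1 : ℤ) ^ (d - 1)) • S d := by
    refine Finset.sum_bij (fun r _ => 2 * m + 1 - r) ?_ ?_ ?_ ?_
    · intro r hr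
      rw [Finset.mem_Icc] at *; omega
    · intro a ha b hb h
      rw [Finset.mem_Icc] at *
      omega
    · intro d hd
      rw [Finset.mem_Icc] at hd
      exact ⟨2 * m + 1 - d, by rw [Finset.mem_Icc]; omega, by omega⟩
    · intro r hr
      rw [Finset.mem_Icc] at hr
      rw [← neg_smul]
      congr 1
      rcases Nat.even_or_odd r with h | h
      · have h2 : Odd (r - 1) := by rw [Nat.even_iff] at h; rw [Nat.odd_iff]; omega
        have h3 : Even (2 * m + 1 - r - 1) := by rw [Nat.even_iff] at *; omega
        rw [h2.neg_one_pow, h3.neg_one_pow]; rfl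
      · have h2 : Even (r - 1) := by rw [Nat.odd_iff] at h; rw [Nat.even_iff]; omega
        have h3 : Odd (2 * m + 1 - r - 1) := by rw [Nat.odd_iff] at *; omega
        rw [h2.neg_one_pow, h3.neg_one_pow]
  rw [h, ← Finset.sum_union]
  · congr 1
    ext x
    simp only [Finset.mem_union, Finset.mem_Icc]
    omega
  · rw [Finset.disjoint_left]
    intro x
    simp only [Finset.mem_Icc]
    omega

theorem stmt12 (n k c : ℕ) (hn : Odd n) (hn3 : 3 ≤ n)
    (hk1 : 1 ≤ k) (hk2 : k ≤ n - 2) (hgcd : Nat.gcd n (k * (k + 1)) = 1)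
    (hc1 : 1 ≤ c) (hc2 : c ≤ n - 1) (hc : (c * (k + 1)) % n = 1)
    (M : Type*) [AddCommGroup M] [Module ℤ M]
    (e : ZMod n → M) (he0 : e 0 = 0)
    (heInd : LinearIndependent ℤ (fun i : {x : ZMod n // x ≠ 0} => e i.val))
    (hk : k = n - 3) :
    Δ n k c e = ∑ r ∈ Finset.Icc 2 ((n - 1) / 2), ((-1 : ℤ) ^ (r - 1)) • T n e (r : ZMod n) := by
  obtain ⟨m, rfl⟩ := hn
  have hm : 2 ≤ m := by omega
  have hk' : k = 2 * m - 2 := by omega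
  subst hk'
  have hcm : c = m := by
    have h1 : (2 * c + 1) % (2 * m + 1) = 0 := by
      have h2 : c * (2 * m - 2 + 1) + 2 * c = c * (2 * m + 1) := by
        rw [show 2 * m + 1 = (2 * m - 2 + 1) + 2 by omega]; ring
      have h3 : (c * (2 * m - 2 + 1) + 2 * c) % (2 * m + 1) = 0 := by rw [h2]; simp
      have h4 : (1 + 2 * c) % (2 * m + 1) = 0 := by
        rw [Nat.add_mod, hc] at h3
        rw [Nat.add_mod, Nat.mod_eq_of_lt (show 1 < 2 * m + 1 by omega)]
        exact h3
      rwa [add_comm]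
    have h5 := (zdvd m (2 * c + 1) (by omega) (by omega)).1
      ((ZMod.natCast_eq_zero_iff _ _).2 (Nat.dvd_of_mod_eq_zero h1))
    omega
  subst hcm
  rw [Delta_eq c hm e he0, fold_sum c hm]
  have hh : (2 * c + 1 - 1) / 2 = c := by omega
  rw [hh]
  refine Finset.sum_congr rfl fun r hr => ?_
  rw [Finset.mem_Icc] at hr
  rw [T_eq _ _ _ (by omega)]

end Stmt
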